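/- Suppose C, K, B, and all N_j are analytic at σ_1,…,σ_k ∈ ℂ and that K(σ_i) and K̂(σ_i) = Wᴴ K(σ_i) V are invertible for all i = 1,…,k. Let b ∈ ℂ^m, c ∈ ℂ^p, d^{(1)},…,d^{(k-1)} ∈ ℂ^m, and nonnegative integers ℓ_1,…,ℓ_k be given. Let the column space of V contain the Hermite interpolation vectors v_{1,j_1} = ∂_{s^{j_1}}(K^{-1}B)(σ_1) b (j_1 = 0,…,ℓ_1) and v_{i,j_i} = ∂_{s^{j_i}}K^{-1}(σ_i) · ∂_{s^{ℓ_{i-1}}}(𝔑(·,d^{(i-1)}) K^{-1})(σ_{i-1}) ⋯ ∂_{s^{ℓ_1}}(𝔑(·,d^{(1)}) K^{-1} B)(σ_1) b (2 ≤ i ≤ k, j_i = 0,…,ℓ_i), and let the column space of W contain w_{1,i} = (∂_{s^i}(cᴴ C K^{-1})(σ_k))ᴴ (i = 0,…,ℓ_k) and w_{i,j} = (∂_{s^j}(w_{i-1,ℓ_{k-i+2}}ᴴ 𝔑(·,d^{(k-i+1)}) K^{-1})(σ_{k-i+1}))ᴴ (2 ≤ i ≤ k, j = 0,…,ℓ_{k-i+1}),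 i.e., identical points, scaling vectors, and derivative orders on both sides. Then all first-order partial derivatives of the function (s_1,…,s_k, d^{(1)},…,d^{(k-1)}) ↦ cᴴ ∂_{s_1^{ℓ_1} ⋯ s_k^{ℓ_k}} 𝔾_k(s_1,…,s_k | d^{(1)},…,d^{(k-1)}) b — with respect to each s_i and each component of each d^{(j)} — coincide with those of the corresponding reduced-order function with 𝔾_k replaced by 𝔾̂_k, evaluated at (σ_1,…,σ_k, d^{(1)},…,d^{(k-1)}). -/

import Mathlib

open Matrix
open scoped Kronecker

namespace StructBilin

/-- Scaled sum of the bilinear terms: `𝔑(s, d) = ∑ i, d i • N i s`. -/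
noncomputable def Nsum {n m : ℕ} (N : Fin m → ℂ → Matrix (Fin n) (Fin n) ℂ) (s : ℂ)
    (d : Fin m → ℂ) : Matrix (Fin n) (Fin n) ℂ :=
  ∑ i, d i • N i s

/-- Middle factor of the modified transfer function
`𝔾_{q+1}(σ 0, …, σ q | d 0, …, d (q-1)) = C (σ q) * gAux K B N σ d q`. -/
noncomputable def gAux {n m : ℕ} (K : ℂ → Matrix (Fin n) (Fin n) ℂ)
    (B : ℂ → Matrix (Fin n) (Fin m) ℂ) (N : Fin m → ℂ → Matrix (Fin n) (Fin n) ℂ)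
    (σ : ℕ → ℂ) (d : ℕ → Fin m → ℂ) : ℕ → Matrix (Fin n) (Fin m) ℂ
  | 0 => (K (σ 0))⁻¹ * B (σ 0)
  | j + 1 => (K (σ (j + 1)))⁻¹ * Nsum N (σ j) (d j) * gAux K B N σ d j

/-- The modified (scaled and summed) transfer function
`𝔾_{q+1}(σ 0, …, σ q | d 0, …, d (q-1))` (the level is `q + 1`, indices are 0-based). -/
noncomputable def Gmod {n m p : ℕ} (C : ℂ → Matrix (Fin p) (Fin n) ℂ)
    (K : ℂ → Matrix (Fin n) (Fin n) ℂ) (B : ℂ → Matrix (Fin n) (Fin m) ℂ)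
    (N : Fin m → ℂ → Matrix (Fin n) (Fin n) ℂ) (σ : ℕ → ℂ) (d : ℕ → Fin m → ℂ)
    (q : ℕ) : Matrix (Fin p) (Fin m) ℂ :=
  C (σ q) * gAux K B N σ d q

/-- Right tangential interpolation vectors:
`v 0 = K(σ 0)⁻¹ B(σ 0) b`, `v (j+1) = K(σ (j+1))⁻¹ 𝔑(σ j, d j) v j`. -/
noncomputable def vtan {n m : ℕ} (K : ℂ → Matrix (Fin n) (Fin n) ℂ)
    (B : ℂ → Matrix (Fin n) (Fin m) ℂ) (N : Fin m → ℂ → Matrix (Fin n) (Fin n) ℂ)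
    (σ : ℕ → ℂ) (d : ℕ → Fin m → ℂ) (b : Fin m → ℂ) : ℕ → Fin n → ℂ
  | 0 => (K (σ 0))⁻¹ *ᵥ (B (σ 0) *ᵥ b)
  | j + 1 => (K (σ (j + 1)))⁻¹ *ᵥ (Nsum N (σ j) (d j) *ᵥ vtan K B N σ d b j)

/-- Left tangential interpolation vectors (with reversed point sequence `τ` and
scaling sequence `e`):
`w 0 = K(τ 0)^{-ᴴ} C(τ 0)ᴴ c`, `w (t+1) = K(τ (t+1))^{-ᴴ} 𝔑(τ (t+1), e t)ᴴ w t`. -/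
noncomputable def wtan {n m p : ℕ} (C : ℂ → Matrix (Fin p) (Fin n) ℂ)
    (K : ℂ → Matrix (Fin n) (Fin n) ℂ) (N : Fin m → ℂ → Matrix (Fin n) (Fin n) ℂ)
    (τ : ℕ → ℂ) (e : ℕ → Fin m → ℂ) (c : Fin p → ℂ) : ℕ → Fin n → ℂ
  | 0 => ((K (τ 0))⁻¹)ᴴ *ᵥ ((C (τ 0))ᴴ *ᵥ c)
  | t + 1 => ((K (τ (t + 1)))⁻¹)ᴴ *ᵥ ((Nsum N (τ (t + 1)) (e t))ᴴ *ᵥ wtan C K N τ e c t)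

/-- Entrywise `t`-th complex derivative of a matrix-valued function. -/
noncomputable def mDeriv {α β : Type*} (t : ℕ) (f : ℂ → Matrix α β ℂ) (z : ℂ) :
    Matrix α β ℂ :=
  Matrix.of fun i j => iteratedDeriv t (fun w => f w i j) z

/-- Entrywise `t`-th complex derivative of a vector-valued function. -/
noncomputable def vDeriv {α : Type*} (t : ℕ) (f : ℂ → α → ℂ) (z : ℂ) : α → ℂ :=
  fun i => iteratedDeriv t (fun w => f w i) z

/-- Partial derivative in the `i`-th coordinate of a function of countably many
complex variables. -/
noncomputable def pD (i : ℕ) (f : (ℕ → ℂ) → ℂ) (s : ℕ → ℂ) : ℂ :=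
  deriv (fun z => f (Function.update s i z)) (s i)

/-- Mixed partial derivative `∂_{s_1^{ord 0} ⋯ s_t^{ord (t-1)}}` of a function of the
first `t` coordinates. -/
noncomputable def mixedD (ord : ℕ → ℕ) : ℕ → ((ℕ → ℂ) → ℂ) → (ℕ → ℂ) → ℂ
  | 0, f => f
  | t + 1, f => mixedD ord t ((pD t)^[ord t] f)

/-- The Hermite chain
`hChain t = ∂^{ℓ (t)}(𝔑(·, d t) K⁻¹)(σ t) ⋯ ∂^{ℓ 0}(𝔑(·, d 0) K⁻¹ B)(σ 0)`. -/
noncomputable def hChain {n m : ℕ} (K : ℂ → Matrix (Fin n) (Fin n) ℂ)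
    (B : ℂ → Matrix (Fin n) (Fin m) ℂ) (N : Fin m → ℂ → Matrix (Fin n) (Fin n) ℂ)
    (σ : ℕ → ℂ) (d : ℕ → Fin m → ℂ) (ℓ : ℕ → ℕ) : ℕ → Matrix (Fin n) (Fin m) ℂ
  | 0 => mDeriv (ℓ 0) (fun z => Nsum N z (d 0) * ((K z)⁻¹ * B z)) (σ 0)
  | t + 1 =>
      mDeriv (ℓ (t + 1)) (fun z => Nsum N z (d (t + 1)) * (K z)⁻¹) (σ (t + 1)) *
        hChain K B N σ d ℓ t

/-- Right tangential Hermite interpolation vectors. -/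
noncomputable def vHerm {n m : ℕ} (K : ℂ → Matrix (Fin n) (Fin n) ℂ)
    (B : ℂ → Matrix (Fin n) (Fin m) ℂ) (N : Fin m → ℂ → Matrix (Fin n) (Fin n) ℂ)
    (σ : ℕ → ℂ) (d : ℕ → Fin m → ℂ) (ℓ : ℕ → ℕ) (b : Fin m → ℂ) : ℕ → ℕ → Fin n → ℂ
  | 0, j => mDeriv j (fun z => (K z)⁻¹ * B z) (σ 0) *ᵥ b
  | t + 1, j => (mDeriv j (fun z => (K z)⁻¹) (σ (t + 1)) * hChain K B N σ d ℓ t) *ᵥ b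

/-- Left tangential Hermite interpolation vectors (with reversed sequences). -/
noncomputable def wHerm {n m p : ℕ} (C : ℂ → Matrix (Fin p) (Fin n) ℂ)
    (K : ℂ → Matrix (Fin n) (Fin n) ℂ) (N : Fin m → ℂ → Matrix (Fin n) (Fin n) ℂ)
    (τ : ℕ → ℂ) (e : ℕ → Fin m → ℂ) (eν : ℕ → ℕ) (c : Fin p → ℂ) : ℕ → ℕ → Fin n → ℂ
  | 0, i => star (vDeriv i (fun z => Matrix.vecMul (star c) (C z * (K z)⁻¹)) (τ 0))
  | t + 1, j =>
      star (vDeriv j (fun z =>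
        Matrix.vecMul (star (wHerm C K N τ e eν c t (eν t))) (Nsum N z (e t) * (K z)⁻¹))
        (τ (t + 1)))

/-- Column index type of the `j+1`-st subsystem transfer function (`m^(j+1)` indices). -/
def colT (m : ℕ) : ℕ → Type
  | 0 => Fin m
  | j + 1 => Fin m × colT m j

def colTFintype (m : ℕ) : ∀ j, Fintype (colT m j)
  | 0 => inferInstanceAs (Fintype (Fin m))
  | j + 1 => letI := colTFintype m j; inferInstanceAs (Fintype (Fin m × colT m j))

attribute [instance] colTFintype

/-- Block index type (`m^j` indices). -/
def outT (m : ℕ) : ℕ → Type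
  | 0 => Fin 1
  | j + 1 => Fin m × outT m j

def outTFintype (m : ℕ) : ∀ j, Fintype (outT m j)
  | 0 => inferInstanceAs (Fintype (Fin 1))
  | j + 1 => letI := outTFintype m j; inferInstanceAs (Fintype (Fin m × outT m j))

attribute [instance] outTFintype

/-- The horizontal concatenation `N(s) = [N_1(s) ⋯ N_m(s)]`. -/
noncomputable def Nbig {n m : ℕ} (N : Fin m → ℂ → Matrix (Fin n) (Fin n) ℂ) (s : ℂ) :
    Matrix (Fin n) (Fin m × Fin n) ℂ :=
  Matrix.of fun i q => N q.1 s i q.2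

/-- The vertical concatenation `Ñ(s)` of `N_1(s), …, N_m(s)`. -/
noncomputable def Ntil {n m : ℕ} (N : Fin m → ℂ → Matrix (Fin n) (Fin n) ℂ) (s : ℂ) :
    Matrix (Fin m × Fin n) (Fin n) ℂ :=
  Matrix.of fun q i => N q.1 s q.2 i

/-- State part of the `j+1`-st subsystem transfer function:
`Z 0 = K(σ 0)⁻¹ B(σ 0)`, `Z (j+1) = K(σ (j+1))⁻¹ N(σ j) (I_m ⊗ Z j)`. -/
noncomputable def Zblk {n m : ℕ} (K : ℂ → Matrix (Fin n) (Fin n) ℂ)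
    (B : ℂ → Matrix (Fin n) (Fin m) ℂ) (N : Fin m → ℂ → Matrix (Fin n) (Fin n) ℂ)
    (σ : ℕ → ℂ) : (j : ℕ) → Matrix (Fin n) (colT m j) ℂ
  | 0 => (K (σ 0))⁻¹ * B (σ 0)
  | j + 1 =>
      (K (σ (j + 1)))⁻¹ * Nbig N (σ j) *
        ((1 : Matrix (Fin m) (Fin m) ℂ) ⊗ₖ Zblk K B N σ j)

/-- The `q+1`-st subsystem transfer function `G_{q+1}(σ 0, …, σ q)`. -/
noncomputable def Gblk {n m p : ℕ} (C : ℂ → Matrix (Fin p) (Fin n) ℂ)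
    (K : ℂ → Matrix (Fin n) (Fin n) ℂ) (B : ℂ → Matrix (Fin n) (Fin m) ℂ)
    (N : Fin m → ℂ → Matrix (Fin n) (Fin n) ℂ) (σ : ℕ → ℂ) (q : ℕ) :
    Matrix (Fin p) (colT m q) ℂ :=
  C (σ q) * Zblk K B N σ q

/-- The tangential direction matrix `I_{m^j} ⊗ b`. -/
noncomputable def tangMat {m : ℕ} (b : Fin m → ℂ) :
    (j : ℕ) → Matrix (colT m j) (outT m j) ℂ
  | 0 => Matrix.of fun i _ => b i
  | j + 1 => (1 : Matrix (Fin m) (Fin m) ℂ) ⊗ₖ tangMat b j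

/-- Blockwise right interpolation matrices:
`V 0 = K(σ 0)⁻¹ B(σ 0) b`, `V (j+1) = K(σ (j+1))⁻¹ N(σ j) (I_m ⊗ V j)`. -/
noncomputable def Vblk {n m : ℕ} (K : ℂ → Matrix (Fin n) (Fin n) ℂ)
    (B : ℂ → Matrix (Fin n) (Fin m) ℂ) (N : Fin m → ℂ → Matrix (Fin n) (Fin n) ℂ)
    (σ : ℕ → ℂ) (b : Fin m → ℂ) : (j : ℕ) → Matrix (Fin n) (outT m j) ℂ
  | 0 => Matrix.of fun i _ => ((K (σ 0))⁻¹ *ᵥ (B (σ 0) *ᵥ b)) i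
  | j + 1 =>
      (K (σ (j + 1)))⁻¹ * Nbig N (σ j) *
        ((1 : Matrix (Fin m) (Fin m) ℂ) ⊗ₖ Vblk K B N σ b j)

/-- Blockwise left interpolation matrices (with reversed point sequence `τ`):
`W 0 = K(τ 0)^{-ᴴ} C(τ 0)ᴴ c`, `W (t+1) = K(τ (t+1))^{-ᴴ} Ñ(τ (t+1))ᴴ (I_m ⊗ W t)`. -/
noncomputable def Wblk {n m p : ℕ} (C : ℂ → Matrix (Fin p) (Fin n) ℂ)
    (K : ℂ → Matrix (Fin n) (Fin n) ℂ) (N : Fin m → ℂ → Matrix (Fin n) (Fin n) ℂ)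
    (τ : ℕ → ℂ) (c : Fin p → ℂ) : (t : ℕ) → Matrix (Fin n) (outT m t) ℂ
  | 0 => Matrix.of fun i _ => (((K (τ 0))⁻¹)ᴴ *ᵥ ((C (τ 0))ᴴ *ᵥ c)) i
  | t + 1 =>
      ((K (τ (t + 1)))⁻¹)ᴴ * (Ntil N (τ (t + 1)))ᴴ *
        ((1 : Matrix (Fin m) (Fin m) ℂ) ⊗ₖ Wblk C K N τ c t)

/-- A vector as a one-column matrix. -/
noncomputable def bCol {m : ℕ} (b : Fin m → ℂ) : Matrix (Fin m) (Fin 1) ℂ :=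
  Matrix.of fun i _ => b i

/-- Blockwise Hermite chain. -/
noncomputable def hChainB {n m : ℕ} (K : ℂ → Matrix (Fin n) (Fin n) ℂ)
    (B : ℂ → Matrix (Fin n) (Fin m) ℂ) (N : Fin m → ℂ → Matrix (Fin n) (Fin n) ℂ)
    (σ : ℕ → ℂ) (ℓ : ℕ → ℕ) (b : Fin m → ℂ) :
    (t : ℕ) → Matrix (Fin n) (outT m (t + 1)) ℂ
  | 0 => mDeriv (ℓ 0)
      (fun z => Nbig N z * ((1 : Matrix (Fin m) (Fin m) ℂ) ⊗ₖ ((K z)⁻¹ * B z * bCol b)))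
      (σ 0)
  | t + 1 =>
      mDeriv (ℓ (t + 1))
        (fun z => Nbig N z * ((1 : Matrix (Fin m) (Fin m) ℂ) ⊗ₖ (K z)⁻¹)) (σ (t + 1)) *
        ((1 : Matrix (Fin m) (Fin m) ℂ) ⊗ₖ hChainB K B N σ ℓ b t)

/-- Blockwise right Hermite interpolation matrices. -/
noncomputable def vHermB {n m : ℕ} (K : ℂ → Matrix (Fin n) (Fin n) ℂ)
    (B : ℂ → Matrix (Fin n) (Fin m) ℂ) (N : Fin m → ℂ → Matrix (Fin n) (Fin n) ℂ)
    (σ : ℕ → ℂ) (ℓ : ℕ → ℕ) (b : Fin m → ℂ) : (t : ℕ) → ℕ → Matrix (Fin n) (outT m t) ℂ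
  | 0, j => mDeriv j (fun z => (K z)⁻¹ * B z * bCol b) (σ 0)
  | t + 1, j => mDeriv j (fun z => (K z)⁻¹) (σ (t + 1)) * hChainB K B N σ ℓ b t

/-- Blockwise left Hermite interpolation matrices (with reversed sequences). -/
noncomputable def wHermB {n m p : ℕ} (C : ℂ → Matrix (Fin p) (Fin n) ℂ)
    (K : ℂ → Matrix (Fin n) (Fin n) ℂ) (N : Fin m → ℂ → Matrix (Fin n) (Fin n) ℂ)
    (τ : ℕ → ℂ) (eν : ℕ → ℕ) (c : Fin p → ℂ) : (t : ℕ) → ℕ → Matrix (Fin n) (outT m t) ℂ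
  | 0, i => Matrix.of fun idx _ =>
      star (iteratedDeriv i (fun z => Matrix.vecMul (star c) (C z * (K z)⁻¹) idx) (τ 0))
  | t + 1, j => Matrix.of fun idx cc =>
      star (iteratedDeriv j (fun z =>
        (((1 : Matrix (Fin m) (Fin m) ℂ) ⊗ₖ wHermB C K N τ eν c t (eν t))ᴴ * Ntil N z *
          (K z)⁻¹) cc idx) (τ (t + 1)))

/-- The Kronecker product `d (j-1) ⊗ ⋯ ⊗ d 0 ⊗ I_m` of scaling vectors with the identity. -/
noncomputable def dKron {m : ℕ} (d : ℕ → Fin m → ℂ) :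
    (j : ℕ) → Matrix (colT m j) (Fin m) ℂ
  | 0 => (1 : Matrix (Fin m) (Fin m) ℂ)
  | j + 1 => Matrix.of fun (pq : Fin m × colT m j) cix => d j pq.1 * dKron d j pq.2 cix

/-- The innermost (input) coordinate of a column multi-index. -/
def innerIdx (m : ℕ) : (j : ℕ) → colT m j → Fin m
  | 0 => fun x => x
  | j + 1 => fun (pq : Fin m × colT m j) => innerIdx m j pq.2

/-- The chain `K(σ t)⁻¹ N_{J (t-1)}(σ (t-1)) ⋯ N_{J 0}(σ 0) K(σ 0)⁻¹ B(σ 0)`. -/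
noncomputable def eChain {n m : ℕ} (K : ℂ → Matrix (Fin n) (Fin n) ℂ)
    (B : ℂ → Matrix (Fin n) (Fin m) ℂ) (N : Fin m → ℂ → Matrix (Fin n) (Fin n) ℂ)
    (σ : ℕ → ℂ) (J : ℕ → Fin m) : ℕ → Matrix (Fin n) (Fin m) ℂ
  | 0 => (K (σ 0))⁻¹ * B (σ 0)
  | t + 1 => (K (σ (t + 1)))⁻¹ * N (J t) (σ t) * eChain K B N σ J t

section Analytic

variable {α β γ : Type*}

/-- Entrywise analyticity of a vector-valued function. -/
def VecAnalyticAt {ι : Type*} (f : ℂ → ι → ℂ) (z : ℂ) : Prop :=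
  ∀ a, AnalyticAt ℂ (fun y => f y a) z

/-- Entrywise analyticity of a matrix-valued function. -/
def MatAnalyticAt {ι κ : Type*} (M : ℂ → Matrix ι κ ℂ) (z : ℂ) : Prop :=
  ∀ a e, AnalyticAt ℂ (fun y => M y a e) z

/-- Every entry of `f` vanishes at `z` to order at least `e`. -/
def VecVanishesAt {ι : Type*} (e : ℕ) (f : ℂ → ι → ℂ) (z : ℂ) : Prop :=
  ∀ a, (e : ℕ∞) ≤ analyticOrderAt (fun y => f y a) z

lemma matAnalyticAt_const (M : Matrix α β ℂ) (z : ℂ) : MatAnalyticAt (fun _ => M) z :=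
  fun _ _ => analyticAt_const

lemma vecAnalyticAt_const (v : α → ℂ) (z : ℂ) : VecAnalyticAt (fun _ => v) z :=
  fun _ => analyticAt_const

lemma MatAnalyticAt.mul [Fintype β] {M : ℂ → Matrix α β ℂ} {M' : ℂ → Matrix β γ ℂ} {z : ℂ}
    (h : MatAnalyticAt M z) (h' : MatAnalyticAt M' z) :
    MatAnalyticAt (fun y => M y * M' y) z := fun a e => by
  simp only [Matrix.mul_apply]
  exact Finset.analyticAt_fun_sum _ fun i _ => (h a i).fun_mul (h' i e)

lemma MatAnalyticAt.sub {M M' : ℂ → Matrix α β ℂ} {z : ℂ}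
    (h : MatAnalyticAt M z) (h' : MatAnalyticAt M' z) :
    MatAnalyticAt (fun y => M y - M' y) z := fun a e => (h a e).fun_sub (h' a e)

lemma MatAnalyticAt.transpose {M : ℂ → Matrix α β ℂ} {z : ℂ}
    (h : MatAnalyticAt M z) : MatAnalyticAt (fun y => (M y)ᵀ) z := fun a e => h e a

lemma MatAnalyticAt.mulVec [Fintype β] {M : ℂ → Matrix α β ℂ} {f : ℂ → β → ℂ} {z : ℂ}
    (h : MatAnalyticAt M z) (h' : VecAnalyticAt f z) :
    VecAnalyticAt (fun y => M y *ᵥ f y) z := fun a => by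
  simp only [Matrix.mulVec, dotProduct]
  exact Finset.analyticAt_fun_sum _ fun i _ => (h a i).fun_mul (h' i)

lemma MatAnalyticAt.vecMul [Fintype α] {M : ℂ → Matrix α β ℂ} {f : ℂ → α → ℂ} {z : ℂ}
    (h : MatAnalyticAt M z) (h' : VecAnalyticAt f z) :
    VecAnalyticAt (fun y => f y ᵥ* M y) z := by
  simpa only [Matrix.mulVec_transpose] using h.transpose.mulVec h'

lemma VecAnalyticAt.sub {f g : ℂ → α → ℂ} {z : ℂ}
    (h : VecAnalyticAt f z) (h' : VecAnalyticAt g z) :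
    VecAnalyticAt (fun y => f y - g y) z := fun a => (h a).fun_sub (h' a)

lemma VecAnalyticAt.dotProduct [Fintype α] {f g : ℂ → α → ℂ} {z : ℂ}
    (h : VecAnalyticAt f z) (h' : VecAnalyticAt g z) :
    AnalyticAt ℂ (fun y => f y ⬝ᵥ g y) z :=
  Finset.analyticAt_fun_sum _ fun i _ => (h i).fun_mul (h' i)

lemma MatAnalyticAt.det [Fintype α] [DecidableEq α] {M : ℂ → Matrix α α ℂ} {z : ℂ}
    (h : MatAnalyticAt M z) : AnalyticAt ℂ (fun y => (M y).det) z := by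
  simp only [Matrix.det_apply']
  exact Finset.analyticAt_fun_sum _ fun i _ =>
    analyticAt_const.fun_mul (Finset.analyticAt_fun_prod _ fun j _ => h _ _)

lemma MatAnalyticAt.inv [Fintype α] [DecidableEq α] {M : ℂ → Matrix α α ℂ} {z : ℂ}
    (h : MatAnalyticAt M z) (hu : IsUnit (M z).det) : MatAnalyticAt (fun y => (M y)⁻¹) z := by
  intro a e
  simp only [Matrix.inv_def, Matrix.smul_apply, Ring.inverse_eq_inv', smul_eq_mul,
    Matrix.adjugate_apply]
  refine (h.det.fun_inv hu.ne_zero).fun_mul (MatAnalyticAt.det fun i j => ?_)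
  by_cases hi : i = e
  · subst hi
    simpa using analyticAt_const
  · simpa [Matrix.updateRow_ne hi] using h i j

lemma MatAnalyticAt.eventually_isUnit_det [Fintype α] [DecidableEq α] {M : ℂ → Matrix α α ℂ} {z : ℂ}
    (h : MatAnalyticAt M z) (hu : IsUnit (M z).det) : ∀ᶠ y in nhds z, IsUnit (M y).det := by
  filter_upwards [h.det.continuousAt.eventually_ne hu.ne_zero] with y hy
  exact isUnit_iff_ne_zero.2 hy

lemma MatAnalyticAt.eventually [Fintype α] [Fintype β] {M : ℂ → Matrix α β ℂ} {z : ℂ}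
    (h : MatAnalyticAt M z) : ∀ᶠ y in nhds z, MatAnalyticAt M y := by
  simp only [MatAnalyticAt, Filter.eventually_all]
  exact fun a e => (h a e).eventually_analyticAt

lemma vDeriv_mulVec [Fintype β] (t : ℕ) (M : Matrix α β ℂ) {f : ℂ → β → ℂ} {z : ℂ}
    (h : VecAnalyticAt f z) : vDeriv t (fun y => M *ᵥ f y) z = M *ᵥ vDeriv t f z := by
  ext a
  simp only [vDeriv, Matrix.mulVec, dotProduct]
  rw [iteratedDeriv_fun_sum fun i _ => (analyticAt_const.fun_mul (h i)).contDiffAt]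
  simp

lemma iteratedDeriv_dotProduct_const [Fintype α] (t : ℕ) (v : α → ℂ) {f : ℂ → α → ℂ} {z : ℂ}
    (h : VecAnalyticAt f z) :
    iteratedDeriv t (fun y => f y ⬝ᵥ v) z = vDeriv t f z ⬝ᵥ v := by
  simp only [vDeriv, dotProduct]
  rw [iteratedDeriv_fun_sum fun i _ => ((h i).fun_mul analyticAt_const).contDiffAt]
  simp

lemma iteratedDeriv_const_dotProduct [Fintype α] (t : ℕ) (v : α → ℂ) {f : ℂ → α → ℂ} {z : ℂ}
    (h : VecAnalyticAt f z) :
    iteratedDeriv t (fun y => v ⬝ᵥ f y) z = v ⬝ᵥ vDeriv t f z := by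
  simpa only [dotProduct_comm v] using iteratedDeriv_dotProduct_const t v h

lemma mDeriv_mulVec [Fintype β] (t : ℕ) {M : ℂ → Matrix α β ℂ} (v : β → ℂ) {z : ℂ}
    (h : MatAnalyticAt M z) : mDeriv t M z *ᵥ v = vDeriv t (fun y => M y *ᵥ v) z := by
  ext a
  exact (iteratedDeriv_dotProduct_const t v (h a)).symm

lemma vDeriv_sub (t : ℕ) {f g : ℂ → α → ℂ} {z : ℂ}
    (h : VecAnalyticAt f z) (h' : VecAnalyticAt g z) :
    vDeriv t (fun y => f y - g y) z = vDeriv t f z - vDeriv t g z := by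
  ext a
  exact iteratedDeriv_fun_sub (h a).contDiffAt (h' a).contDiffAt

lemma VecVanishesAt.congr {e : ℕ} {f g : ℂ → α → ℂ} {z : ℂ} (h : VecVanishesAt e f z)
    (hfg : f =ᶠ[nhds z] g) : VecVanishesAt e g z := fun a => by
  rw [← analyticOrderAt_congr (hfg.mono fun y hy => congrFun hy a : (fun y => f y a) =ᶠ[nhds z] fun y => g y a)]
  exact h a

lemma natCast_le_analyticOrderAt_finset_sum {ι : Type*} (s : Finset ι) {f : ι → ℂ → ℂ} {z : ℂ}
    {e : ℕ} (h : ∀ i ∈ s, (e : ℕ∞) ≤ analyticOrderAt (f i) z) :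
    (e : ℕ∞) ≤ analyticOrderAt (fun y => ∑ i ∈ s, f i y) z := by
  classical
  induction s using Finset.induction_on with
  | empty =>
    simp only [Finset.sum_empty]
    rw [analyticOrderAt_eq_top.2 (by simp)]
    exact le_top
  | insert i s hi ih =>
    simp only [Finset.sum_insert hi]
    exact (le_min (h i (by simp)) (ih fun j hj => h j (by simp [hj]))).trans
      le_analyticOrderAt_add

lemma VecVanishesAt.dotProduct [Fintype α] {e e' : ℕ} {f g : ℂ → α → ℂ} {z : ℂ}
    (hf : VecAnalyticAt f z) (hg : VecAnalyticAt g z)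
    (h : VecVanishesAt e f z) (h' : VecVanishesAt e' g z) :
    ((e + e' : ℕ) : ℕ∞) ≤ analyticOrderAt (fun y => f y ⬝ᵥ g y) z := by
  refine natCast_le_analyticOrderAt_finset_sum _ fun i _ => ?_
  have := analyticOrderAt_mul (hf i) (hg i)
  rw [Pi.mul_def] at this
  rw [this, Nat.cast_add]
  exact add_le_add (h i) (h' i)

lemma vecVanishesAt_zero (f : ℂ → α → ℂ) (z : ℂ) : VecVanishesAt 0 f z := fun _ => by simp

lemma VecVanishesAt.mulVec [Fintype β] {e : ℕ} {M : ℂ → Matrix α β ℂ} {f : ℂ → β → ℂ} {z : ℂ}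
    (hM : MatAnalyticAt M z) (hf : VecAnalyticAt f z) (h : VecVanishesAt e f z) :
    VecVanishesAt e (fun y => M y *ᵥ f y) z := fun a => by
  have := VecVanishesAt.dotProduct (hM a) hf (vecVanishesAt_zero _ z) h
  rwa [zero_add] at this

lemma vecVanishesAt_iff {e : ℕ} {f : ℂ → α → ℂ} {z : ℂ} (hf : VecAnalyticAt f z) :
    VecVanishesAt e f z ↔ ∀ j < e, vDeriv j f z = 0 := by
  simp only [VecVanishesAt, vDeriv, funext_iff, Pi.zero_apply,
    fun a => natCast_le_analyticOrderAt_iff_iteratedDeriv_eq_zero (n := e) (hf a)]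
  exact ⟨fun h j hj a => h a j hj, fun h a j hj => h j hj a⟩

end Analytic

section Projection

variable {α β : Type*} [Fintype α] [Fintype β] [DecidableEq α] [DecidableEq β]

/-- If the derivatives of `K⁻¹ h` up to order `l` lie in the range of `V`, then the
Petrov-Galerkin approximation of `K⁻¹ h` is exact to order `l`. -/
lemma vecVanishesAt_projection_error {K : ℂ → Matrix α α ℂ} {h : ℂ → α → ℂ} {z : ℂ} {l : ℕ}
    (V : Matrix α β ℂ) (A : Matrix β α ℂ) (hKa : MatAnalyticAt K z) (hha : VecAnalyticAt h z)
    (hK : IsUnit (K z).det) (hKr : IsUnit (A * K z * V).det)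
    (hV : ∀ j ≤ l, vDeriv j (fun y => (K y)⁻¹ *ᵥ h y) z ∈ Set.range V.mulVec) :
    VecVanishesAt (l + 1)
      (fun y => (K y)⁻¹ *ᵥ h y - V *ᵥ ((A * K y * V)⁻¹ *ᵥ (A *ᵥ h y))) z := by
  have hKra : MatAnalyticAt (fun y => A * K y * V) z :=
    ((matAnalyticAt_const A z).mul hKa).mul (matAnalyticAt_const V z)
  set x : ℂ → α → ℂ := fun y => (K y)⁻¹ *ᵥ h y with hx
  have hxa : VecAnalyticAt x z := (hKa.inv hK).mulVec hha
  set L : Matrix β α ℂ := (A * K z * V)⁻¹ * (A * K z) with hL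
  have hLV : L * V = 1 := by
    rw [hL, Matrix.mul_assoc]
    exact Matrix.nonsing_inv_mul _ hKr
  have hea : VecAnalyticAt (fun y => x y - (V * L) *ᵥ x y) z :=
    hxa.sub ((matAnalyticAt_const (V * L) z).mulVec hxa)
  have he : VecVanishesAt (l + 1) (fun y => x y - (V * L) *ᵥ x y) z := by
    rw [vecVanishesAt_iff hea]
    intro j hj
    obtain ⟨a, ha⟩ := hV j (Nat.lt_succ_iff.1 hj)
    rw [vDeriv_sub _ hxa ((matAnalyticAt_const (V * L) z).mulVec hxa), vDeriv_mulVec _ _ hxa,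
      ← ha, Matrix.mulVec_mulVec, Matrix.mul_assoc, hLV, Matrix.mul_one, sub_self]
  have hPa : MatAnalyticAt (fun y => 1 - V * (A * K y * V)⁻¹ * A * K y) z :=
    (matAnalyticAt_const 1 z).sub ((((matAnalyticAt_const V z).mul (hKra.inv hKr)).mul
      (matAnalyticAt_const A z)).mul hKa)
  refine (he.mulVec hPa hea).congr ?_
  filter_upwards [hKa.eventually_isUnit_det hK, hKra.eventually_isUnit_det hKr] with y hy hyr
  have hPV : (1 - V * (A * K y * V)⁻¹ * A * K y) * V = 0 := by
    have : V * (A * K y * V)⁻¹ * A * K y * V = V * ((A * K y * V)⁻¹ * (A * K y * V)) := by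
      simp only [Matrix.mul_assoc]
    rw [Matrix.sub_mul, this, Matrix.nonsing_inv_mul _ hyr, Matrix.one_mul, Matrix.mul_one,
      sub_self]
  have hKx : K y *ᵥ x y = h y := by
    rw [hx, Matrix.mulVec_mulVec, Matrix.mul_nonsing_inv _ hy, Matrix.one_mulVec]
  rw [Matrix.mulVec_sub, Matrix.mulVec_mulVec _ _ (V * L), ← Matrix.mul_assoc, hPV, Matrix.zero_mul,
    Matrix.zero_mulVec, sub_zero, Matrix.sub_mulVec, Matrix.one_mulVec, ← Matrix.mulVec_mulVec,
    hKx]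
  simp only [x, Matrix.mulVec_mulVec, Matrix.mul_assoc]

/-- Left version of `vecVanishesAt_projection_error`. -/
lemma vecVanishesAt_projection_error_left {K : ℂ → Matrix α α ℂ} {u : ℂ → α → ℂ} {z : ℂ} {l : ℕ}
    (V : Matrix α β ℂ) (A : Matrix β α ℂ) (hKa : MatAnalyticAt K z) (hua : VecAnalyticAt u z)
    (hK : IsUnit (K z).det) (hKr : IsUnit (A * K z * V).det)
    (hA : ∀ j ≤ l, vDeriv j (fun y => u y ᵥ* (K y)⁻¹) z ∈ Set.range A.vecMul) :
    VecVanishesAt (l + 1)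
      (fun y => u y ᵥ* (K y)⁻¹ - ((u y ᵥ* V) ᵥ* (A * K y * V)⁻¹) ᵥ* A) z := by
  have hT : ∀ y, Vᵀ * (K y)ᵀ * Aᵀ = (A * K y * V)ᵀ := fun y => by
    simp only [Matrix.transpose_mul, Matrix.mul_assoc]
  have := vecVanishesAt_projection_error (K := fun y => (K y)ᵀ) (h := u) (z := z) (l := l)
    Aᵀ Vᵀ hKa.transpose hua (by rwa [Matrix.det_transpose])
    (by rwa [hT, Matrix.det_transpose])
    (by simpa only [← Matrix.transpose_nonsing_inv, Matrix.mulVec_transpose,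
      funext (Matrix.mulVec_transpose A)] using hA)
  simpa only [hT, ← Matrix.transpose_nonsing_inv, Matrix.mulVec_transpose] using this

end Projection

section MixedDerivative

lemma pD_iterate (i t : ℕ) (f : (ℕ → ℂ) → ℂ) (s : ℕ → ℂ) :
    (pD i)^[t] f s = iteratedDeriv t (fun z => f (Function.update s i z)) (s i) := by
  induction t generalizing s with
  | zero => simp
  | succ t ih =>
    rw [Function.iterate_succ_apply', iteratedDeriv_succ]
    simp only [pD, ih, Function.update_self, Function.update_idem]

lemma mixedD_congr (ord : ℕ → ℕ) (t : ℕ) {f g : (ℕ → ℂ) → ℂ} {s : ℕ → ℂ}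
    (h : ∀ s' : ℕ → ℂ, (∀ j, t ≤ j → s' j = s j) → f s' = g s') :
    mixedD ord t f s = mixedD ord t g s := by
  induction t generalizing f g with
  | zero => exact h s fun _ _ => rfl
  | succ t ih =>
    refine ih fun s' hs' => ?_
    rw [pD_iterate, pD_iterate]
    congr 1
    funext z
    refine h _ fun j hj => ?_
    rw [Function.update_of_ne (by omega), hs' j (by omega)]

end MixedDerivative

section Chains

variable {n m p : ℕ} {C : ℂ → Matrix (Fin p) (Fin n) ℂ} {K : ℂ → Matrix (Fin n) (Fin n) ℂ}
  {B : ℂ → Matrix (Fin n) (Fin m) ℂ} {N : Fin m → ℂ → Matrix (Fin n) (Fin n) ℂ}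

/-- The system matrices are analytic at `z` and `K z` is invertible. -/
structure RegularAt (C : ℂ → Matrix (Fin p) (Fin n) ℂ) (K : ℂ → Matrix (Fin n) (Fin n) ℂ)
    (B : ℂ → Matrix (Fin n) (Fin m) ℂ) (N : Fin m → ℂ → Matrix (Fin n) (Fin n) ℂ)
    (z : ℂ) : Prop where
  output : MatAnalyticAt C z
  state : MatAnalyticAt K z
  input : MatAnalyticAt B z
  bilinear : ∀ ι, MatAnalyticAt (N ι) z
  isUnit : IsUnit (K z).det

lemma RegularAt.eventually {z : ℂ} (h : RegularAt C K B N z) :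
    ∀ᶠ y in nhds z, RegularAt C K B N y := by
  filter_upwards [h.output.eventually, h.state.eventually, h.input.eventually,
    Filter.eventually_all.2 fun ι => (h.bilinear ι).eventually,
    h.state.eventually_isUnit_det h.isUnit] with y h1 h2 h3 h4 h5
  exact ⟨h1, h2, h3, h4, h5⟩

lemma RegularAt.nsum {z : ℂ} (h : RegularAt C K B N z) (d : Fin m → ℂ) :
    MatAnalyticAt (fun y => Nsum N y d) z := fun a e => by
  simp only [Nsum, Matrix.sum_apply, Matrix.smul_apply, smul_eq_mul]
  exact Finset.analyticAt_fun_sum _ fun ι _ => analyticAt_const.fun_mul (h.bilinear ι a e)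

lemma RegularAt.inv {z : ℂ} (h : RegularAt C K B N z) :
    MatAnalyticAt (fun y => (K y)⁻¹) z :=
  h.state.inv h.isUnit

/-- The right-hand side of the `t`-th linear system in the right Hermite chain, so that the
interpolation vectors are the derivatives of `K⁻¹ * rightRhs t`. -/
noncomputable def rightRhs (K : ℂ → Matrix (Fin n) (Fin n) ℂ)
    (B : ℂ → Matrix (Fin n) (Fin m) ℂ) (N : Fin m → ℂ → Matrix (Fin n) (Fin n) ℂ)
    (σ : ℕ → ℂ) (d : ℕ → Fin m → ℂ) (ℓ : ℕ → ℕ) (b : Fin m → ℂ) : ℕ → ℂ → Fin n → ℂ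
  | 0, z => B z *ᵥ b
  | t + 1, _ =>
      vDeriv (ℓ t) (fun y => Nsum N y (d t) *ᵥ ((K y)⁻¹ *ᵥ rightRhs K B N σ d ℓ b t y)) (σ t)

/-- The left-hand row vector of the `t`-th linear system in the left Hermite chain. -/
noncomputable def leftRow (C : ℂ → Matrix (Fin p) (Fin n) ℂ)
    (K : ℂ → Matrix (Fin n) (Fin n) ℂ) (N : Fin m → ℂ → Matrix (Fin n) (Fin n) ℂ)
    (τ : ℕ → ℂ) (e : ℕ → Fin m → ℂ) (ν : ℕ → ℕ) (c : Fin p → ℂ) : ℕ → ℂ → Fin n → ℂ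
  | 0, z => star c ᵥ* C z
  | t + 1, z =>
      vDeriv (ν t) (fun y => leftRow C K N τ e ν c t y ᵥ* (K y)⁻¹) (τ t) ᵥ* Nsum N z (e t)

lemma RegularAt.rightRhs {z : ℂ} (h : RegularAt C K B N z) (σ : ℕ → ℂ) (d : ℕ → Fin m → ℂ)
    (ℓ : ℕ → ℕ) (b : Fin m → ℂ) (t : ℕ) : VecAnalyticAt (rightRhs K B N σ d ℓ b t) z := by
  cases t with
  | zero => exact h.input.mulVec (vecAnalyticAt_const b z)
  | succ t => exact vecAnalyticAt_const _ z

lemma RegularAt.leftRow {z : ℂ} (h : RegularAt C K B N z) (τ : ℕ → ℂ) (e : ℕ → Fin m → ℂ)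
    (ν : ℕ → ℕ) (c : Fin p → ℂ) (t : ℕ) : VecAnalyticAt (leftRow C K N τ e ν c t) z := by
  cases t with
  | zero => exact h.output.vecMul (vecAnalyticAt_const _ z)
  | succ t => exact (h.nsum (e t)).vecMul (vecAnalyticAt_const _ z)

lemma rightRhs_congr {σ σ' : ℕ → ℂ} {d d' : ℕ → Fin m → ℂ} (ℓ : ℕ → ℕ) (b : Fin m → ℂ) (t : ℕ)
    (hσ : ∀ j < t, σ j = σ' j) (hd : ∀ j < t, d j = d' j) :
    rightRhs K B N σ d ℓ b t = rightRhs K B N σ' d' ℓ b t := by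
  induction t with
  | zero => rfl
  | succ t ih =>
    funext z
    simp only [rightRhs]
    rw [ih (fun j hj => hσ j (by omega)) fun j hj => hd j (by omega), hσ t (by omega),
      hd t (by omega)]

lemma leftRow_congr {τ τ' : ℕ → ℂ} {e e' : ℕ → Fin m → ℂ} (ν : ℕ → ℕ) (c : Fin p → ℂ) (t : ℕ)
    (hτ : ∀ j < t, τ j = τ' j) (he : ∀ j < t, e j = e' j) :
    leftRow C K N τ e ν c t = leftRow C K N τ' e' ν c t := by
  induction t with
  | zero => rfl
  | succ t ih =>
    funext z
    simp only [leftRow]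
    rw [ih (fun j hj => hτ j (by omega)) fun j hj => he j (by omega), hτ t (by omega),
      he t (by omega)]

lemma hChain_mulVec {σ : ℕ → ℂ} (d : ℕ → Fin m → ℂ) (ℓ : ℕ → ℕ) (b : Fin m → ℂ) (t : ℕ)
    (h : ∀ j ≤ t, RegularAt C K B N (σ j)) (z : ℂ) :
    hChain K B N σ d ℓ t *ᵥ b = rightRhs K B N σ d ℓ b (t + 1) z := by
  induction t generalizing z with
  | zero =>
    have h0 := h 0 le_rfl
    rw [hChain, mDeriv_mulVec _ _ ((h0.nsum _).mul (h0.inv.mul h0.input))]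
    simp only [rightRhs, Matrix.mulVec_mulVec]
  | succ t ih =>
    have h0 := h (t + 1) le_rfl
    rw [hChain, ← Matrix.mulVec_mulVec, ih (fun j hj => h j (by omega)) 0,
      mDeriv_mulVec _ _ ((h0.nsum _).mul h0.inv)]
    simp only [rightRhs, Matrix.mulVec_mulVec]

lemma vHerm_eq {σ : ℕ → ℂ} (d : ℕ → Fin m → ℂ) (ℓ : ℕ → ℕ) (b : Fin m → ℂ) (t j : ℕ)
    (h : ∀ j ≤ t, RegularAt C K B N (σ j)) :
    vHerm K B N σ d ℓ b t j =
      vDeriv j (fun y => (K y)⁻¹ *ᵥ rightRhs K B N σ d ℓ b t y) (σ t) := by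
  have ht := h t le_rfl
  cases t with
  | zero =>
    rw [vHerm, mDeriv_mulVec _ _ (ht.inv.mul ht.input)]
    simp only [rightRhs, Matrix.mulVec_mulVec]
  | succ t =>
    rw [vHerm, ← Matrix.mulVec_mulVec, hChain_mulVec d ℓ b t (fun j hj => h j (by omega)) 0,
      mDeriv_mulVec _ _ ht.inv]
    rfl

lemma wHerm_eq (τ : ℕ → ℂ) (e : ℕ → Fin m → ℂ) (ν : ℕ → ℕ) (c : Fin p → ℂ) (t j : ℕ) :
    wHerm C K N τ e ν c t j =
      star (vDeriv j (fun y => leftRow C K N τ e ν c t y ᵥ* (K y)⁻¹) (τ t)) := by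
  induction t generalizing j with
  | zero => simp only [wHerm, leftRow, Matrix.vecMul_vecMul]
  | succ t ih => simp only [wHerm, leftRow, Matrix.vecMul_vecMul, ih, star_star]

lemma gAux_congr {s s' : ℕ → ℂ} (d : ℕ → Fin m → ℂ) (t : ℕ) (h : ∀ j ≤ t, s j = s' j) :
    gAux K B N s d t = gAux K B N s' d t := by
  induction t with
  | zero => simp only [gAux, h 0 le_rfl]
  | succ t ih =>
    simp only [gAux, h (t + 1) le_rfl, h t (by omega), ih fun j hj => h j (by omega)]

lemma mixedD_gAux_succ {σ : ℕ → ℂ} (d : ℕ → Fin m → ℂ) (ℓ : ℕ → ℕ) (b : Fin m → ℂ) (t : ℕ)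
    {u : ℂ → Fin n → ℂ} (h : RegularAt C K B N (σ (t + 1))) (hu : VecAnalyticAt u (σ (t + 1))) :
    mixedD ℓ (t + 2) (fun s => u (s (t + 1)) ⬝ᵥ (gAux K B N s d (t + 1) *ᵥ b)) σ =
      mixedD ℓ (t + 1) (fun s =>
        (vDeriv (ℓ (t + 1)) (fun y => u y ᵥ* (K y)⁻¹) (σ (t + 1)) ᵥ* Nsum N (s t) (d t)) ⬝ᵥ
          (gAux K B N s d t *ᵥ b)) σ := by
  rw [mixedD]
  refine mixedD_congr ℓ (t + 1) fun s hs => ?_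
  rw [pD_iterate, hs (t + 1) le_rfl]
  have : ∀ z, u z ⬝ᵥ (gAux K B N (Function.update s (t + 1) z) d (t + 1) *ᵥ b) =
      (u z ᵥ* (K z)⁻¹) ⬝ᵥ (Nsum N (s t) (d t) *ᵥ (gAux K B N s d t *ᵥ b)) := fun z => by
    rw [gAux, gAux_congr (s' := s) d t
      fun j hj => Function.update_of_ne (by omega) _ _, Function.update_self,
      Function.update_of_ne (by omega), ← Matrix.mulVec_mulVec, ← Matrix.mulVec_mulVec,
      Matrix.dotProduct_mulVec]
  simp only [Function.update_self, this]
  rw [iteratedDeriv_dotProduct_const _ _ (h.inv.vecMul hu), Matrix.dotProduct_mulVec]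

lemma mixedD_gAux {σ : ℕ → ℂ} (d : ℕ → Fin m → ℂ) (ℓ : ℕ → ℕ) (b : Fin m → ℂ) (t : ℕ)
    {u : ℂ → Fin n → ℂ} (h : ∀ j ≤ t, RegularAt C K B N (σ j)) (hu : VecAnalyticAt u (σ t)) :
    mixedD ℓ (t + 1) (fun s => u (s t) ⬝ᵥ (gAux K B N s d t *ᵥ b)) σ =
      iteratedDeriv (ℓ t) (fun y => u y ⬝ᵥ ((K y)⁻¹ *ᵥ rightRhs K B N σ d ℓ b t y)) (σ t) := by
  induction t generalizing u with
  | zero => simp only [mixedD, pD_iterate, Function.update_self, gAux, rightRhs,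
      Matrix.mulVec_mulVec]
  | succ t ih =>
    have ht := h t (by omega)
    have ht1 := h (t + 1) le_rfl
    rw [mixedD_gAux_succ d ℓ b t ht1 hu,
      ih (u := fun y => _ ᵥ* Nsum N y (d t)) (fun j hj => h j (by omega))
        ((ht.nsum _).vecMul (vecAnalyticAt_const _ _))]
    simp only [← Matrix.dotProduct_mulVec]
    rw [iteratedDeriv_const_dotProduct _ _
      ((ht.nsum _).mulVec (ht.inv.mulVec (ht.rightRhs σ d ℓ b t)))]
    simp only [Matrix.dotProduct_mulVec (u _), rightRhs]
    rw [iteratedDeriv_dotProduct_const _ _ (ht1.inv.vecMul hu)]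

/-- The mixed derivative of the transfer function, with the `i`-th variable split off. -/
lemma mixedD_Gmod {σ : ℕ → ℂ} (d : ℕ → Fin m → ℂ) (ℓ : ℕ → ℕ) (b : Fin m → ℂ) (c : Fin p → ℂ)
    {q i t : ℕ} (hit : i + t = q) (h : ∀ j ≤ q, RegularAt C K B N (σ j)) :
    mixedD ℓ (q + 1) (fun s => star c ⬝ᵥ (Gmod C K B N s d q *ᵥ b)) σ =
      iteratedDeriv (ℓ i) (fun y =>
        leftRow C K N (fun t => σ (q - t)) (fun t => d (q - 1 - t)) (fun t => ℓ (q - t)) c t y ⬝ᵥ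
          ((K y)⁻¹ *ᵥ rightRhs K B N σ d ℓ b i y)) (σ i) := by
  rw [← mixedD_gAux d ℓ b i (fun j hj => h j (by omega)) ((h i (by omega)).leftRow _ _ _ _ _)]
  induction t generalizing i with
  | zero =>
    obtain rfl : i = q := by omega
    simp only [Gmod, leftRow, ← Matrix.mulVec_mulVec, Matrix.dotProduct_mulVec]
  | succ t ih =>
    rw [ih (i := i + 1) (by omega), mixedD_gAux_succ d ℓ b i (h (i + 1) (by omega))
      ((h (i + 1) (by omega)).leftRow _ _ _ _ _)]
    have hσ : q - t = i + 1 := by omega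
    have hd : q - 1 - t = i := by omega
    simp only [leftRow, hσ, hd]

lemma pD_mixedD_Gmod {σ : ℕ → ℂ} (d : ℕ → Fin m → ℂ) (ℓ : ℕ → ℕ) (b : Fin m → ℂ)
    (c : Fin p → ℂ) {q i t : ℕ} (hit : i + t = q) (h : ∀ j ≤ q, RegularAt C K B N (σ j)) :
    pD i (mixedD ℓ (q + 1) (fun s => star c ⬝ᵥ (Gmod C K B N s d q *ᵥ b))) σ =
      iteratedDeriv (ℓ i + 1) (fun y =>
        leftRow C K N (fun t => σ (q - t)) (fun t => d (q - 1 - t)) (fun t => ℓ (q - t)) c t y ⬝ᵥ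
          ((K y)⁻¹ *ᵥ rightRhs K B N σ d ℓ b i y)) (σ i) := by
  rw [pD, iteratedDeriv_succ]
  refine Filter.EventuallyEq.deriv_eq ?_
  have hreg : ∀ᶠ z in nhds (σ i), ∀ j ∈ Set.Iic q,
      RegularAt C K B N (Function.update σ i z j) := by
    refine (Filter.eventually_all_finite (Set.finite_Iic q)).2 fun j hj => ?_
    rcases eq_or_ne j i with rfl | hji
    · simpa only [Function.update_self] using (h j hj).eventually
    · simpa only [Function.update_of_ne hji] using Filter.Eventually.of_forall fun _ => h j hj
  filter_upwards [hreg] with z hz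
  rw [mixedD_Gmod d ℓ b c hit hz, Function.update_self,
    rightRhs_congr (σ' := σ) (d' := d) ℓ b i
      (fun j hj => Function.update_of_ne (by omega) _ _) fun _ _ => rfl,
    leftRow_congr (τ' := fun t => σ (q - t)) _ c t
      (fun j hj => Function.update_of_ne (by omega) _ _) fun _ _ => rfl]

end Chains

section Reduction

variable {n m p r : ℕ} {C : ℂ → Matrix (Fin p) (Fin n) ℂ} {K : ℂ → Matrix (Fin n) (Fin n) ℂ}
  {B : ℂ → Matrix (Fin n) (Fin m) ℂ} {N : Fin m → ℂ → Matrix (Fin n) (Fin n) ℂ}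
  {V : Matrix (Fin n) (Fin r) ℂ} {A : Matrix (Fin r) (Fin n) ℂ}

lemma Nsum_reduced (V : Matrix (Fin n) (Fin r) ℂ) (A : Matrix (Fin r) (Fin n) ℂ) (z : ℂ)
    (d : Fin m → ℂ) :
    Nsum (fun ι s => A * N ι s * V) z d = A * Nsum N z d * V := by
  simp only [Nsum, Matrix.mul_sum, Matrix.sum_mul, Matrix.mul_smul, Matrix.smul_mul]

lemma RegularAt.reduced {z : ℂ} (h : RegularAt C K B N z) (hKr : IsUnit (A * K z * V).det) :
    RegularAt (fun s => C s * V) (fun s => A * K s * V) (fun s => A * B s)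
      (fun ι s => A * N ι s * V) z where
  output := h.output.mul (matAnalyticAt_const V z)
  state := ((matAnalyticAt_const A z).mul h.state).mul (matAnalyticAt_const V z)
  input := (matAnalyticAt_const A z).mul h.input
  bilinear ι := ((matAnalyticAt_const A z).mul (h.bilinear ι)).mul (matAnalyticAt_const V z)
  isUnit := hKr

lemma rightRhs_reduced {σ : ℕ → ℂ} (d : ℕ → Fin m → ℂ) (ℓ : ℕ → ℕ) (b : Fin m → ℂ) (t : ℕ)
    (h : ∀ j < t, RegularAt C K B N (σ j)) (hKr : ∀ j < t, IsUnit (A * K (σ j) * V).det)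
    (hV : ∀ i < t, ∀ j ≤ ℓ i,
      vDeriv j (fun y => (K y)⁻¹ *ᵥ rightRhs K B N σ d ℓ b i y) (σ i) ∈ Set.range V.mulVec)
    (z : ℂ) :
    rightRhs (fun s => A * K s * V) (fun s => A * B s) (fun ι s => A * N ι s * V) σ d ℓ b t z =
      A *ᵥ rightRhs K B N σ d ℓ b t z := by
  induction t generalizing z with
  | zero => simp only [rightRhs, Matrix.mulVec_mulVec]
  | succ t ih =>
    have ht := h t (by omega)
    have htr := ht.reduced (hKr t (by omega))
    have hH := ht.rightRhs σ d ℓ b t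
    have hAH := (matAnalyticAt_const A (σ t)).mulVec hH
    have hx := ht.inv.mulVec hH
    have hxr := htr.inv.mulVec hAH
    have herr := vecVanishesAt_projection_error V A ht.state hH ht.isUnit (hKr t (by omega))
      (hV t (by omega))
    have hAN := (matAnalyticAt_const A (σ t)).mul (ht.nsum (d t))
    have herra := hx.sub ((matAnalyticAt_const V (σ t)).mulVec hxr)
    simp only [rightRhs, Nsum_reduced, ih (fun j hj => h j (by omega))
      (fun j hj => hKr j (by omega)) fun i hi => hV i (by omega)]
    rw [← vDeriv_mulVec _ _ ((ht.nsum _).mulVec hx), eq_comm, ← sub_eq_zero,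
      ← vDeriv_sub _ ((matAnalyticAt_const A _).mulVec ((ht.nsum _).mulVec hx))
        ((hAN.mul (matAnalyticAt_const V _)).mulVec hxr)]
    have := (vecVanishesAt_iff (hAN.mulVec herra)).1 (herr.mulVec hAN herra) (ℓ t) (by omega)
    simpa only [Matrix.mulVec_sub, Matrix.mulVec_mulVec, Matrix.mul_assoc] using this

lemma leftRow_reduced {τ : ℕ → ℂ} (e : ℕ → Fin m → ℂ) (ν : ℕ → ℕ) (c : Fin p → ℂ) (t : ℕ)
    (h : ∀ j < t, RegularAt C K B N (τ j)) (hKr : ∀ j < t, IsUnit (A * K (τ j) * V).det)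
    (hA : ∀ i < t, ∀ j ≤ ν i,
      vDeriv j (fun y => leftRow C K N τ e ν c i y ᵥ* (K y)⁻¹) (τ i) ∈ Set.range A.vecMul)
    (z : ℂ) :
    leftRow (fun s => C s * V) (fun s => A * K s * V) (fun ι s => A * N ι s * V) τ e ν c t z =
      leftRow C K N τ e ν c t z ᵥ* V := by
  induction t generalizing z with
  | zero => simp only [leftRow, Matrix.vecMul_vecMul]
  | succ t ih =>
    have ht := h t (by omega)
    have htr := ht.reduced (hKr t (by omega))
    have hU := ht.leftRow τ e ν c t
    have hy := ht.inv.vecMul hU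
    have hyr := htr.inv.vecMul ((matAnalyticAt_const V (τ t)).vecMul hU)
    have hyrA := (matAnalyticAt_const A (τ t)).vecMul hyr
    have herr := vecVanishesAt_projection_error_left V A ht.state hU ht.isUnit
      (hKr t (by omega)) (hA t (by omega))
    have hzero := (vecVanishesAt_iff (hy.sub hyrA)).1 herr (ν t) (by omega)
    rw [vDeriv_sub _ hy hyrA, sub_eq_zero] at hzero
    simp only [← Matrix.mulVec_transpose A] at hzero
    rw [vDeriv_mulVec _ _ hyr, Matrix.mulVec_transpose] at hzero
    simp only [leftRow, Nsum_reduced, ih (fun j hj => h j (by omega))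
      (fun j hj => hKr j (by omega)) fun i hi => hA i (by omega)]
    rw [hzero]
    simp only [Matrix.vecMul_vecMul, Matrix.mul_assoc]

/-- If both the primal and the dual solutions are reproduced to order `l`, then all derivatives
of `u K⁻¹ h` up to order `2 l + 1` are reproduced. -/
lemma iteratedDeriv_bilinear_form_eq {α β : Type*} [Fintype α] [Fintype β] [DecidableEq α]
    [DecidableEq β] {K : ℂ → Matrix α α ℂ} {u h : ℂ → α → ℂ} {z : ℂ} {l : ℕ}
    (V : Matrix α β ℂ) (A : Matrix β α ℂ) (hKa : MatAnalyticAt K z)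
    (hua : VecAnalyticAt u z) (hha : VecAnalyticAt h z)
    (hK : IsUnit (K z).det) (hKr : IsUnit (A * K z * V).det)
    (hV : ∀ j ≤ l, vDeriv j (fun y => (K y)⁻¹ *ᵥ h y) z ∈ Set.range V.mulVec)
    (hA : ∀ j ≤ l, vDeriv j (fun y => u y ᵥ* (K y)⁻¹) z ∈ Set.range A.vecMul)
    {j : ℕ} (hj : j ≤ 2 * l + 1) :
    iteratedDeriv j (fun y => u y ⬝ᵥ ((K y)⁻¹ *ᵥ h y)) z =
      iteratedDeriv j (fun y => (u y ᵥ* V) ⬝ᵥ ((A * K y * V)⁻¹ *ᵥ (A *ᵥ h y))) z := by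
  have hKra : MatAnalyticAt (fun y => A * K y * V) z :=
    ((matAnalyticAt_const A z).mul hKa).mul (matAnalyticAt_const V z)
  have hx := (hKa.inv hK).mulVec hha
  have hxr := (hKra.inv hKr).mulVec ((matAnalyticAt_const A z).mulVec hha)
  have huV := (matAnalyticAt_const V z).vecMul hua
  have hex := hx.sub ((matAnalyticAt_const V z).mulVec hxr)
  have hey := ((hKa.inv hK).vecMul hua).sub
    ((matAnalyticAt_const A z).vecMul ((hKra.inv hKr).vecMul huV))
  have hf := hua.dotProduct hx
  have hfr := huV.dotProduct hxr
  rw [← sub_eq_zero, ← iteratedDeriv_fun_sub hf.contDiffAt hfr.contDiffAt]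
  refine (natCast_le_analyticOrderAt_iff_iteratedDeriv_eq_zero (n := (l + 1) + (l + 1))
    (hf.fun_sub hfr)).1 ?_ j (by omega)
  refine (VecVanishesAt.dotProduct hey (hKa.mulVec hex)
    (vecVanishesAt_projection_error_left V A hKa hua hK hKr hA)
    ((vecVanishesAt_projection_error V A hKa hha hK hKr hV).mulVec hKa hex)).trans_eq
    (analyticOrderAt_congr ?_)
  filter_upwards [hKa.eventually_isUnit_det hK, hKra.eventually_isUnit_det hKr] with y hy hyr
  have h1 : (K y)⁻¹ * K y = 1 := Matrix.nonsing_inv_mul _ hy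
  have h2 : K y * (K y)⁻¹ = 1 := Matrix.mul_nonsing_inv _ hy
  have h3 : (A * K y * V)⁻¹ * (A * K y * V) = 1 := Matrix.nonsing_inv_mul _ hyr
  have hKx : K y *ᵥ ((K y)⁻¹ *ᵥ h y) = h y := by
    rw [Matrix.mulVec_mulVec, h2, Matrix.one_mulVec]
  set R := (A * K y * V)⁻¹
  have hyV : (u y ᵥ* (K y)⁻¹) ⬝ᵥ (K y *ᵥ (V *ᵥ (R *ᵥ (A *ᵥ h y)))) =
      (u y ᵥ* V) ⬝ᵥ (R *ᵥ (A *ᵥ h y)) := by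
    rw [Matrix.dotProduct_mulVec, Matrix.vecMul_vecMul, h1, Matrix.vecMul_one,
      Matrix.dotProduct_mulVec]
  have hyrV : (((u y ᵥ* V) ᵥ* R) ᵥ* A) ⬝ᵥ (K y *ᵥ (V *ᵥ (R *ᵥ (A *ᵥ h y)))) =
      (u y ᵥ* V) ⬝ᵥ (R *ᵥ (A *ᵥ h y)) := by
    have : R * (A * (K y * V)) = 1 := by rw [← h3, Matrix.mul_assoc A]
    rw [Matrix.dotProduct_mulVec, Matrix.dotProduct_mulVec, Matrix.vecMul_vecMul,
      Matrix.vecMul_vecMul, Matrix.vecMul_vecMul, this, Matrix.vecMul_one]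
  rw [Matrix.mulVec_sub, hKx, sub_dotProduct, dotProduct_sub, dotProduct_sub, hyV, hyrV,
    ← Matrix.dotProduct_mulVec (u y), ← Matrix.dotProduct_mulVec _ A,
    ← Matrix.dotProduct_mulVec _ R, sub_self, sub_zero]

/-- Matching only the primal solution to order `l` reproduces the derivatives up to order `l`. -/
lemma iteratedDeriv_bilinear_form_eq_of_right {α β : Type*} [Fintype α] [Fintype β]
    [DecidableEq α] [DecidableEq β] {K : ℂ → Matrix α α ℂ} {u h : ℂ → α → ℂ} {z : ℂ} {l : ℕ}
    (V : Matrix α β ℂ) (A : Matrix β α ℂ) (hKa : MatAnalyticAt K z)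
    (hua : VecAnalyticAt u z) (hha : VecAnalyticAt h z)
    (hK : IsUnit (K z).det) (hKr : IsUnit (A * K z * V).det)
    (hV : ∀ j ≤ l, vDeriv j (fun y => (K y)⁻¹ *ᵥ h y) z ∈ Set.range V.mulVec)
    {j : ℕ} (hj : j ≤ l) :
    iteratedDeriv j (fun y => u y ⬝ᵥ ((K y)⁻¹ *ᵥ h y)) z =
      iteratedDeriv j (fun y => (u y ᵥ* V) ⬝ᵥ ((A * K y * V)⁻¹ *ᵥ (A *ᵥ h y))) z := by
  have hKra : MatAnalyticAt (fun y => A * K y * V) z :=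
    ((matAnalyticAt_const A z).mul hKa).mul (matAnalyticAt_const V z)
  have hx := (hKa.inv hK).mulVec hha
  have hxr := (hKra.inv hKr).mulVec ((matAnalyticAt_const A z).mulVec hha)
  have huV := (matAnalyticAt_const V z).vecMul hua
  have hex := hx.sub ((matAnalyticAt_const V z).mulVec hxr)
  have hf := hua.dotProduct hx
  have hfr := huV.dotProduct hxr
  rw [← sub_eq_zero, ← iteratedDeriv_fun_sub hf.contDiffAt hfr.contDiffAt]
  refine (natCast_le_analyticOrderAt_iff_iteratedDeriv_eq_zero (n := 0 + (l + 1))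
    (hf.fun_sub hfr)).1 ?_ j (by omega)
  have := VecVanishesAt.dotProduct hua hex (vecVanishesAt_zero u z)
    (vecVanishesAt_projection_error V A hKa hha hK hKr hV)
  simpa only [dotProduct_sub, Matrix.dotProduct_mulVec _ V] using this

end Reduction

theorem stmt_7 {n m p r : ℕ} (hn : 0 < n) (hm : 0 < m) (hp : 0 < p) (hr : 0 < r)
    (C : ℂ → Matrix (Fin p) (Fin n) ℂ) (K : ℂ → Matrix (Fin n) (Fin n) ℂ)
    (B : ℂ → Matrix (Fin n) (Fin m) ℂ) (N : Fin m → ℂ → Matrix (Fin n) (Fin n) ℂ)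
    (V W : Matrix (Fin n) (Fin r) ℂ)
    (k : ℕ) (hk : 0 < k) (σ : ℕ → ℂ) (d : ℕ → Fin m → ℂ) (ℓ : ℕ → ℕ) (b : Fin m → ℂ)
    (c : Fin p → ℂ)
    (hCa : ∀ j < k, ∀ a e, AnalyticAt ℂ (fun z => C z a e) (σ j))
    (hKa : ∀ j < k, ∀ a e, AnalyticAt ℂ (fun z => K z a e) (σ j))
    (hBa : ∀ j < k, ∀ a e, AnalyticAt ℂ (fun z => B z a e) (σ j))
    (hNa : ∀ j < k, ∀ ι a e, AnalyticAt ℂ (fun z => N ι z a e) (σ j))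
    (hK : ∀ j < k, IsUnit (K (σ j)).det)
    (hKr : ∀ j < k, IsUnit (Wᴴ * K (σ j) * V).det)
    (hV : ∀ t < k, ∀ j ≤ ℓ t, vHerm K B N σ d ℓ b t j ∈ Set.range V.mulVec)
    (hW : ∀ t < k, ∀ j ≤ ℓ (k - 1 - t),
      wHerm C K N (fun t => σ (k - 1 - t)) (fun t => d (k - 2 - t))
          (fun t => ℓ (k - 1 - t)) c t j ∈ Set.range W.mulVec) :
    (∀ i < k,
      pD i (mixedD ℓ k (fun s => star c ⬝ᵥ (Gmod C K B N s d (k - 1) *ᵥ b))) σ =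
        pD i (mixedD ℓ k (fun s => star c ⬝ᵥ (Gmod (fun s => C s * V) (fun s => Wᴴ * K s * V) (fun s => Wᴴ * B s) (fun ι s => Wᴴ * N ι s * V) s d (k - 1) *ᵥ b))) σ) ∧
    (∀ j < k - 1, ∀ i : Fin m,
      deriv (fun z =>
          mixedD ℓ k (fun s =>
            star c ⬝ᵥ
              (Gmod C K B N s (Function.update d j (Function.update (d j) i z)) (k - 1) *ᵥ
                b)) σ) (d j i) =
        deriv (fun z =>
          mixedD ℓ k (fun s =>
            star c ⬝ᵥ
              (Gmod (fun s => C s * V) (fun s => Wᴴ * K s * V) (fun s => Wᴴ * B s) (fun ι s => Wᴴ * N ι s * V) s (Function.update d j (Function.update (d j) i z)) (k - 1) *ᵥ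
                b)) σ) (d j i)) := by
  obtain ⟨q, rfl⟩ : ∃ q, k = q + 1 := ⟨k - 1, by omega⟩
  simp only [Nat.add_sub_cancel, show q + 1 - 2 = q - 1 from rfl] at hW ⊢
  have hreg : ∀ j ≤ q, RegularAt C K B N (σ j) := fun j hj =>
    ⟨hCa j (by omega), hKa j (by omega), hBa j (by omega), hNa j (by omega), hK j (by omega)⟩
  have hKr' : ∀ j ≤ q, IsUnit (Wᴴ * K (σ j) * V).det := fun j hj => hKr j (by omega)
  have hregr := fun j (hj : j ≤ q) => (hreg j hj).reduced (hKr' j hj)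
  have hright : ∀ i ≤ q, ∀ j ≤ ℓ i,
      vDeriv j (fun y => (K y)⁻¹ *ᵥ rightRhs K B N σ d ℓ b i y) (σ i) ∈ Set.range V.mulVec :=
    fun i hi j hj => by
      rw [← vHerm_eq d ℓ b i j fun j hj => hreg j (by omega)]
      exact hV i (by omega) j hj
  have hleft : ∀ t ≤ q, ∀ j ≤ ℓ (q - t),
      vDeriv j (fun y => leftRow C K N (fun t => σ (q - t)) (fun t => d (q - 1 - t))
        (fun t => ℓ (q - t)) c t y ᵥ* (K y)⁻¹) (σ (q - t)) ∈ Set.range Wᴴ.vecMul :=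
    fun t ht j hj => by
      obtain ⟨a, ha⟩ := hW t (by omega) j hj
      rw [wHerm_eq] at ha
      refine ⟨star a, ?_⟩
      rw [← star_star (vDeriv _ _ _), ← ha, Matrix.star_mulVec]
  have hleftr := fun t (ht : t ≤ q) => leftRow_reduced (V := V) (A := Wᴴ)
    (τ := fun t => σ (q - t)) (fun t => d (q - 1 - t)) (fun t => ℓ (q - t)) c t
    (fun j _ => hreg _ (Nat.sub_le q j)) (fun j _ => hKr' _ (Nat.sub_le q j))
    fun i hi => hleft i (by omega)
  have hrightr := fun i (hi : i ≤ q) => rightRhs_reduced (V := V) (A := Wᴴ) d ℓ b i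
    (fun j hj => hreg j (by omega)) (fun j hj => hKr' j (by omega))
    fun j hj => hright j (by omega)
  refine ⟨fun i hi => ?_, fun j hj ι => ?_⟩
  · have hiq : i ≤ q := by omega
    have hit : i + (q - i) = q := by omega
    have hqi : q - (q - i) = i := by omega
    rw [pD_mixedD_Gmod d ℓ b c hit hreg, pD_mixedD_Gmod d ℓ b c hit hregr]
    simp only [hleftr (q - i) (by omega), hrightr i hiq]
    have hl := hleft (q - i) (by omega)
    rw [hqi] at hl
    exact iteratedDeriv_bilinear_form_eq V Wᴴ (hreg i hiq).state ((hreg i hiq).leftRow _ _ _ _ _)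
      ((hreg i hiq).rightRhs _ _ _ _ _) (hreg i hiq).isUnit (hKr' i hiq) (hright i hiq) hl
      (by omega)
  · congr 1
    funext z
    have hjq : j ≤ q := by omega
    set d' := Function.update d j (Function.update (d j) ι z)
    have hd' : ∀ i, i ≠ j → d' i = d i := fun i hi => Function.update_of_ne hi _ _
    have hjt : j + (q - 1 - j + 1) = q := by omega
    rw [mixedD_Gmod d' ℓ b c hjt hreg, mixedD_Gmod d' ℓ b c hjt hregr]
    have hR := rightRhs_congr (K := K) (B := B) (N := N) (σ := σ) (σ' := σ) (d := d') (d' := d)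
      ℓ b j (fun _ _ => rfl) fun i hi => hd' i (by omega)
    have hL : ∀ i ≤ q - 1 - j, leftRow C K N (fun t => σ (q - t)) (fun t => d' (q - 1 - t))
        (fun t => ℓ (q - t)) c i = leftRow C K N (fun t => σ (q - t)) (fun t => d (q - 1 - t))
        (fun t => ℓ (q - t)) c i := fun i hi =>
      leftRow_congr _ c i (fun _ _ => rfl) fun s hs => hd' _ (by omega)
    have hRr := rightRhs_reduced (V := V) (A := Wᴴ) d' ℓ b j
      (fun i hi => hreg i (by omega)) (fun i hi => hKr' i (by omega)) fun i hi => by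
        rw [rightRhs_congr (d' := d) (σ' := σ) ℓ b i (fun _ _ => rfl)
          fun s hs => hd' s (by omega)]
        exact hright i (by omega)
    have hLr := leftRow_reduced (V := V) (A := Wᴴ)
      (τ := fun t => σ (q - t)) (fun t => d' (q - 1 - t)) (fun t => ℓ (q - t)) c (q - 1 - j + 1)
      (fun i _ => hreg _ (Nat.sub_le q i)) (fun i _ => hKr' _ (Nat.sub_le q i))
      fun i hi => by
        rw [hL i (by omega)]
        exact hleft i (by omega)
    simp only [hLr, hRr, hR]
    exact iteratedDeriv_bilinear_form_eq_of_right V Wᴴ (hreg j hjq).state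
      ((hreg j hjq).leftRow _ _ _ _ _) ((hreg j hjq).rightRhs _ _ _ _ _) (hreg j hjq).isUnit
      (hKr' j hjq) (hright j hjq) le_rfl

end StructBilin
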